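/- A map σ : G → G is an automorphism of G = ES_2(p,n) if and only if there exist matrices A = [a_{ij}], B = [b_{ij}], C = [c_{ij}], D = [d_{ij}] ∈ M_n(𝔽_p) with M = [[A,C],[D,B]] ∈ GL_{2n}(𝔽_p) satisfying MᵗΔM = a₁₁Δ with a₁₁ ≠ 0, a₁₂ = … = a₁ₙ = 0 and c₁₁ = c₁₂ = … = c₁ₙ = 0, an element a ∈ (ℤ/p²ℤ)^* with a ≡ a₁₁ mod p, and linear functionals α : (ℤ/pℤ)^{n-1} → ℤ/pℤ and β : (ℤ/pℤ)^n → ℤ/pℤ, such that σ(u₁,u,w₁,w) = (a·u₁ + i(s), π(Aũ+Cw̃), Dũ+Bw̃) for all (u₁,u,w₁,w) ∈ G, where ũ = (ū₁,u) ∈ (ℤ/pℤ)^n (ū₁ the reduction of u₁ mod p), w̃ = (w₁,w) ∈ (ℤ/pℤ)^n, π : (ℤ/pℤ)^n → (ℤ/pℤ)^{n-1} deletes the first coordinate, the vector Dũ+Bw̃ ∈ (ℤ/pℤ)^n supplies the last two components (its first coordinate being the new w₁ and the rest the new w), and s = α(u)+β(w̃)+(1/2)ũᵗ(AᵗD)ũ+(1/2)w̃ᵗ(CᵗB)w̃+w̃ᵗ(CᵗD)ũ.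 Moreover any such automorphism necessarily satisfies b₁₁ = 1 and b₂₁ = … = bₙ₁ = c₂₁ = … = cₙ₁ = 0. -/

import Mathlib

open Matrix

/-- The additive embedding `ℤ/pℤ → ℤ/p²ℤ`, `a ↦ p·a`. -/
def emb (p : ℕ) (a : ZMod p) : ZMod (p ^ 2) := (p : ZMod (p ^ 2)) * (a.val : ZMod (p ^ 2))

/-- Reduction modulo `p`, `ℤ/p²ℤ → ℤ/pℤ`. -/
def red (p : ℕ) : ZMod (p ^ 2) →+* ZMod p :=
  ZMod.castHom (dvd_pow_self p (by norm_num)) (ZMod p)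

section EmbLemmas

variable {p : ℕ} [NeZero p]

theorem emb_sq_zero : (p : ZMod (p ^ 2)) * (p : ZMod (p ^ 2)) = 0 := by
  have h : ((p ^ 2 : ℕ) : ZMod (p ^ 2)) = 0 := ZMod.natCast_self _
  push_cast at h
  linear_combination h

theorem emb_mod (k : ℕ) :
    (p : ZMod (p ^ 2)) * ((k % p : ℕ) : ZMod (p ^ 2)) = (p : ZMod (p ^ 2)) * (k : ℕ) := by
  conv_rhs => rw [← Nat.div_add_mod k p]
  push_cast
  linear_combination (-((k / p : ℕ) : ZMod (p ^ 2))) * emb_sq_zero (p := p)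

theorem emb_add (a b : ZMod p) : emb p (a + b) = emb p a + emb p b := by
  unfold emb
  rw [ZMod.val_add, emb_mod]
  push_cast
  ring

theorem emb_zero : emb p (0 : ZMod p) = 0 := by
  simp [emb]

theorem emb_neg (a : ZMod p) : emb p (-a) = -emb p a := by
  have h := emb_add (p := p) (-a) a
  rw [neg_add_cancel, emb_zero] at h
  exact eq_neg_of_add_eq_zero_left h.symm

theorem emb_sub (a b : ZMod p) : emb p (a - b) = emb p a - emb p b := by
  rw [sub_eq_add_neg, emb_add, emb_neg]; ring

theorem emb_mul_emb (a b : ZMod p) : emb p a * emb p b = 0 := by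
  unfold emb
  calc (p : ZMod (p ^ 2)) * (a.val : ZMod (p ^ 2)) * ((p : ZMod (p ^ 2)) * (b.val : ZMod (p ^ 2)))
      = ((p : ZMod (p^2)) * (p : ZMod (p^2))) * ((a.val : ZMod (p ^ 2)) * (b.val : ZMod (p ^ 2))) := by ring
    _ = 0 := by rw [emb_sq_zero]; ring

theorem red_emb (a : ZMod p) : red p (emb p a) = 0 := by
  unfold emb
  rw [_root_.map_mul, map_natCast, ZMod.natCast_self]
  ring

end EmbLemmas

/-- The extra-special `p`-group of exponent `p²` and order `p^(2(m+1)+1)`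
(so `n = m + 1` in the paper's notation). -/
@[ext]
structure ES2 (p m : ℕ) : Type where
  u1 : ZMod (p ^ 2)
  u : Fin m → ZMod p
  w1 : ZMod p
  w : Fin m → ZMod p

namespace ES2

variable {p m : ℕ}

instance : Mul (ES2 p m) :=
  ⟨fun x y => ⟨x.u1 + y.u1 + emb p y.w1 * x.u1 + emb p (x.u ⬝ᵥ y.w),
    x.u + y.u, x.w1 + y.w1, x.w + y.w⟩⟩

@[simp] theorem mul_u1 (x y : ES2 p m) :
    (x * y).u1 = x.u1 + y.u1 + emb p y.w1 * x.u1 + emb p (x.u ⬝ᵥ y.w) := rfl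
@[simp] theorem mul_u (x y : ES2 p m) : (x * y).u = x.u + y.u := rfl
@[simp] theorem mul_w1 (x y : ES2 p m) : (x * y).w1 = x.w1 + y.w1 := rfl
@[simp] theorem mul_w (x y : ES2 p m) : (x * y).w = x.w + y.w := rfl

instance : One (ES2 p m) := ⟨⟨0, 0, 0, 0⟩⟩

@[simp] theorem one_u1 : (1 : ES2 p m).u1 = 0 := rfl
@[simp] theorem one_u : (1 : ES2 p m).u = 0 := rfl
@[simp] theorem one_w1 : (1 : ES2 p m).w1 = 0 := rfl
@[simp] theorem one_w : (1 : ES2 p m).w = 0 := rfl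

instance : Inv (ES2 p m) :=
  ⟨fun x => ⟨(1 - emb p x.w1) * (-x.u1 + emb p (x.u ⬝ᵥ x.w)), -x.u, -x.w1, -x.w⟩⟩

@[simp] theorem inv_u1 (x : ES2 p m) :
    (x⁻¹).u1 = (1 - emb p x.w1) * (-x.u1 + emb p (x.u ⬝ᵥ x.w)) := rfl
@[simp] theorem inv_u (x : ES2 p m) : (x⁻¹).u = -x.u := rfl
@[simp] theorem inv_w1 (x : ES2 p m) : (x⁻¹).w1 = -x.w1 := rfl
@[simp] theorem inv_w (x : ES2 p m) : (x⁻¹).w = -x.w := rfl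

instance [NeZero p] : Group (ES2 p m) :=
  Group.ofLeftAxioms
    (fun a b c => by
      ext
      · simp only [mul_u1, mul_u, mul_w1, mul_w, add_dotProduct, dotProduct_add, emb_add]
        linear_combination a.u1 * emb_mul_emb c.w1 b.w1 +
          emb_mul_emb c.w1 (a.u ⬝ᵥ b.w)
      · simp [add_assoc]
      · simp [add_assoc]
      · simp [add_assoc])
    (fun a => by
      ext <;> simp [emb_zero])
    (fun a => by
      ext
      · simp only [mul_u1, inv_u1, inv_u, inv_w1, inv_w, one_u1, neg_dotProduct, emb_neg]
        linear_combination (a.u1 - emb p (a.u ⬝ᵥ a.w)) * emb_mul_emb a.w1 a.w1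
      · simp
      · simp
      · simp)

end ES2

/-- The standard symplectic matrix `Δ = [[0, Iₙ], [-Iₙ, 0]]`. -/
def Delta (p n : ℕ) : Matrix (Fin n ⊕ Fin n) (Fin n ⊕ Fin n) (ZMod p) :=
  Matrix.fromBlocks 0 1 (-1) 0

/-- `ũ = (u₁ mod p, u) ∈ (ℤ/pℤ)^(m+1)` associated to an element of `ES2 p m`. -/
def utilde {p m : ℕ} (x : ES2 p m) : Fin (m + 1) → ZMod p := Fin.cons (red p x.u1) x.u

/-- `w̃ = (w₁, w) ∈ (ℤ/pℤ)^(m+1)` associated to an element of `ES2 p m`. -/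
def wtilde {p m : ℕ} (x : ES2 p m) : Fin (m + 1) → ZMod p := Fin.cons x.w1 x.w

section Helpers

variable {p m : ℕ} [Fact p.Prime]

theorem mul_emb (a : ZMod (p ^ 2)) (c : ZMod p) : a * emb p c = emb p (red p a * c) := by
  have h1 : ((a.val : ℕ) : ZMod (p ^ 2)) = a := ZMod.natCast_zmod_val a
  have h2 : ((c.val : ℕ) : ZMod p) = c := ZMod.natCast_zmod_val c
  have h3 : red p a * c = ((a.val * c.val : ℕ) : ZMod p) := by
    push_cast
    rw [h2]
    conv_lhs => rw [← h1, map_natCast]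
  rw [h3]
  unfold emb
  rw [ZMod.val_natCast, emb_mod]
  push_cast
  rw [h1]; ring

theorem emb_inj {a b : ZMod p} (h : emb p a = emb p b) : a = b := by
  have hp : p.Prime := Fact.out
  have h0 : ∀ c : ZMod p, emb p c = 0 → c = 0 := by
    intro c hc
    unfold emb at hc
    have h1 : ((p * c.val : ℕ) : ZMod (p ^ 2)) = 0 := by exact_mod_cast hc
    rw [ZMod.natCast_eq_zero_iff, pow_two] at h1
    have h2 := Nat.dvd_of_mul_dvd_mul_left hp.pos h1
    rw [← ZMod.natCast_zmod_val c]
    exact (ZMod.natCast_eq_zero_iff _ _).2 h2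
  have := h0 (a - b) (by rw [emb_sub, h, sub_self])
  exact sub_eq_zero.1 this

theorem exists_emb_of_red {x : ZMod (p ^ 2)} (h : red p x = 0) : ∃ c, x = emb p c := by
  have h1 : ((x.val : ℕ) : ZMod (p ^ 2)) = x := ZMod.natCast_zmod_val x
  rw [← h1, map_natCast, ZMod.natCast_eq_zero_iff] at h
  obtain ⟨k, hk⟩ := h
  refine ⟨(k : ZMod p), ?_⟩
  unfold emb
  rw [ZMod.val_natCast, emb_mod, ← h1, hk]
  push_cast; rfl

theorem isUnit_of_red {x : ZMod (p ^ 2)} (h : red p x ≠ 0) : IsUnit x := by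
  have hp : p.Prime := Fact.out
  have h1 : ((x.val : ℕ) : ZMod (p ^ 2)) = x := ZMod.natCast_zmod_val x
  rw [← h1]
  rw [ZMod.isUnit_iff_coprime]
  apply Nat.Coprime.pow_right
  rw [Nat.coprime_comm, Nat.Prime.coprime_iff_not_dvd hp]
  intro hd
  apply h
  rw [← h1, map_natCast, ZMod.natCast_eq_zero_iff]
  exact hd

theorem red_surj (c : ZMod p) : red p ((c.val : ℕ) : ZMod (p ^ 2)) = c := by
  rw [map_natCast]; exact ZMod.natCast_zmod_val c

theorem utilde_mul (x y : ES2 p m) : utilde (x * y) = utilde x + utilde y := by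
  funext i
  refine Fin.cases ?_ (fun j => ?_) i
  · simp [utilde, red_emb]
  · simp [utilde]

theorem wtilde_mul (x y : ES2 p m) : wtilde (x * y) = wtilde x + wtilde y := by
  funext i
  refine Fin.cases ?_ (fun j => ?_) i
  · simp [wtilde]
  · simp [wtilde]

theorem mul_u1_tilde (x y : ES2 p m) :
    (x * y).u1 = x.u1 + y.u1 + emb p (utilde x ⬝ᵥ wtilde y) := by
  have : utilde x ⬝ᵥ wtilde y = red p x.u1 * y.w1 + x.u ⬝ᵥ y.w := by
    simp [utilde, wtilde, dotProduct, Fin.sum_univ_succ]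
  rw [this, emb_add, ← mul_emb, ES2.mul_u1]; ring

theorem ext_tilde {x y : ES2 p m} (h1 : x.u1 = y.u1) (h2 : utilde x = utilde y)
    (h3 : wtilde x = wtilde y) : x = y := by
  ext j
  · exact h1
  · simpa [utilde] using congrFun h2 j.succ
  · simpa [wtilde] using congrFun h3 0
  · simpa [wtilde] using congrFun h3 j.succ

/-- the image in the symplectic space -/
def Pv (x : ES2 p m) : Fin (m + 1) ⊕ Fin (m + 1) → ZMod p := Sum.elim (utilde x) (wtilde x)

theorem Pv_mul (x y : ES2 p m) : Pv (x * y) = Pv x + Pv y := by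
  funext i
  rcases i with i | i
  · simp [Pv, utilde_mul]
  · simp [Pv, wtilde_mul]

/-- a set-theoretic lift -/
def liftv (v : Fin (m + 1) ⊕ Fin (m + 1) → ZMod p) : ES2 p m :=
  ⟨((v (Sum.inl 0)).val : ℕ), fun j => v (Sum.inl j.succ), v (Sum.inr 0),
    fun j => v (Sum.inr j.succ)⟩

theorem Pv_liftv (v : Fin (m + 1) ⊕ Fin (m + 1) → ZMod p) : Pv (liftv v) = v := by
  funext i
  rcases i with i | i
  · refine Fin.cases ?_ (fun j => ?_) i
    · simp only [Pv, liftv, utilde, Sum.elim_inl, Fin.cons_zero]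
      exact red_surj _
    · simp [Pv, liftv, utilde]
  · refine Fin.cases ?_ (fun j => ?_) i
    · simp [Pv, liftv, wtilde]
    · simp [Pv, liftv, wtilde]

/-- central elements -/
def zc (c : ZMod p) : ES2 p m := ⟨emb p c, 0, 0, 0⟩

theorem utilde_zc (c : ZMod p) : utilde (zc c : ES2 p m) = 0 := by
  funext i
  refine Fin.cases ?_ (fun j => ?_) i
  · simp [utilde, zc, red_emb]
  · simp [utilde, zc]

theorem wtilde_zc (c : ZMod p) : wtilde (zc c : ES2 p m) = 0 := by
  funext i
  refine Fin.cases ?_ (fun j => ?_) i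
  · simp [wtilde, zc]
  · simp [wtilde, zc]

theorem Pv_inj {x y : ES2 p m} (h : Pv x = Pv y) : utilde x = utilde y ∧ wtilde x = wtilde y := by
  constructor
  · funext i; exact congrFun h (Sum.inl i)
  · funext i; exact congrFun h (Sum.inr i)

theorem eq_zc_mul {x y : ES2 p m} (h : Pv x = Pv y) : ∃ c, x = zc c * y := by
  obtain ⟨h1, h2⟩ := Pv_inj h
  have : red p (x.u1 - y.u1) = 0 := by
    have := congrFun h1 0
    simp only [utilde, Fin.cons_zero] at this
    rw [map_sub, this, sub_self]
  obtain ⟨c, hc⟩ := exists_emb_of_red this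
  refine ⟨c, ext_tilde ?_ ?_ ?_⟩
  · rw [mul_u1_tilde, utilde_zc, zero_dotProduct, emb_zero, add_zero]
    simp only [zc]
    rw [← hc]; ring
  · rw [utilde_mul, utilde_zc, zero_add, h1]
  · rw [wtilde_mul, wtilde_zc, zero_add, h2]

theorem zc_add (c d : ZMod p) : (zc (c + d) : ES2 p m) = zc c * zc d := by
  apply ext_tilde
  · rw [mul_u1_tilde, utilde_zc, zero_dotProduct, emb_zero, add_zero]
    simp [zc, emb_add]
  · simp [utilde_mul, utilde_zc]
  · simp [wtilde_mul, wtilde_zc]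

theorem zc_inj {c d : ZMod p} (h : (zc c : ES2 p m) = zc d) : c = d :=
  emb_inj (congrArg ES2.u1 h)

/-- the symplectic form -/
def om (x y : ES2 p m) : ZMod p := utilde x ⬝ᵥ wtilde y - utilde y ⬝ᵥ wtilde x

theorem mul_comm_zc (x y : ES2 p m) : x * y = zc (om x y) * (y * x) := by
  apply ext_tilde
  · simp only [mul_u1_tilde, utilde_zc, zero_dotProduct, emb_zero, add_zero]
    simp only [zc, om, emb_sub]; ring
  · simp only [utilde_mul, utilde_zc]; abel
  · simp only [wtilde_mul, wtilde_zc]; abel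

theorem om_Delta (x y : ES2 p m) : om x y = Pv x ⬝ᵥ (Delta p (m + 1) *ᵥ Pv y) := by
  unfold om Pv Delta
  rw [fromBlocks_mulVec]
  simp only [Matrix.zero_mulVec, Matrix.one_mulVec, Matrix.neg_mulVec, zero_add, add_zero,
    sumElim_dotProduct_sumElim, dotProduct_neg]
  simp only [Sum.elim_comp_inl, Sum.elim_comp_inr]
  rw [dotProduct_comm (utilde y)]; ring

theorem pow_tilde (x : ES2 p m) (j : ℕ) : utilde (x ^ j) = j • utilde x ∧
    wtilde (x ^ j) = j • wtilde x ∧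
    (x ^ j).u1 = j * x.u1 + emb p ((j.choose 2 : ℕ) * (utilde x ⬝ᵥ wtilde x)) := by
  induction j with
  | zero =>
    refine ⟨?_, ?_, ?_⟩
    · have := utilde_zc (p := p) (m := m) 0
      have h : (zc 0 : ES2 p m) = 1 := by ext <;> simp [zc, emb_zero]
      rw [h] at this; simpa using this
    · have := wtilde_zc (p := p) (m := m) 0
      have h : (zc 0 : ES2 p m) = 1 := by ext <;> simp [zc, emb_zero]
      rw [h] at this; simpa using this
    · simp [emb_zero]
  | succ j ih =>
    obtain ⟨h1, h2, h3⟩ := ih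
    refine ⟨?_, ?_, ?_⟩
    · rw [pow_succ, utilde_mul, h1, succ_nsmul]
    · rw [pow_succ, wtilde_mul, h2, succ_nsmul]
    · rw [pow_succ x j, mul_u1_tilde, h3, h1, Nat.choose_succ_succ' j 1, smul_dotProduct,
        Nat.choose_one_right]
      push_cast
      rw [add_mul (j : ZMod p), emb_add, nsmul_eq_mul]
      ring

theorem pow_p (hodd : Odd p) (x : ES2 p m) : x ^ p = zc (utilde x 0) := by
  obtain ⟨h1, h2, h3⟩ := pow_tilde x p
  have hp : p.Prime := Fact.out
  apply ext_tilde
  · rw [h3]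
    have hc : ((p.choose 2 : ℕ) : ZMod p) = 0 := by
      rw [ZMod.natCast_eq_zero_iff]
      refine hp.dvd_choose_self (by norm_num) ?_
      rcases hp.eq_two_or_odd with h | h
      · subst h; exact absurd hodd (by decide)
      · have := hp.two_le
        omega
    rw [hc, zero_mul, emb_zero, add_zero]
    simp only [zc, utilde, Fin.cons_zero]
    have h4 : (p : ZMod (p ^ 2)) = emb p 1 := by
      unfold emb
      haveI : Fact (1 < p) := ⟨hp.one_lt⟩
      rw [ZMod.val_one]; simp
    rw [h4, mul_comm, mul_emb, mul_one]
  · rw [h1, utilde_zc]; simp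
  · rw [h2, wtilde_zc]; simp

/-- quadratic part -/
def s0 (A B C D : Matrix (Fin (m + 1)) (Fin (m + 1)) (ZMod p)) (u w : Fin (m + 1) → ZMod p) :
    ZMod p :=
  (2 : ZMod p)⁻¹ * (u ⬝ᵥ ((Aᵀ * D) *ᵥ u))
                + (2 : ZMod p)⁻¹ * (w ⬝ᵥ ((Cᵀ * B) *ᵥ w))
                + w ⬝ᵥ ((Cᵀ * D) *ᵥ u)

theorem dot_tr (A D : Matrix (Fin (m + 1)) (Fin (m + 1)) (ZMod p)) (u v : Fin (m + 1) → ZMod p) :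
    u ⬝ᵥ ((Aᵀ * D) *ᵥ v) = (A *ᵥ u) ⬝ᵥ (D *ᵥ v) := by
  rw [← Matrix.mulVec_mulVec, Matrix.dotProduct_mulVec, Matrix.vecMul_transpose]

theorem blocks {A B C D : Matrix (Fin (m + 1)) (Fin (m + 1)) (ZMod p)} {k : ZMod p}
    (h : (Matrix.fromBlocks A C D B)ᵀ * Delta p (m + 1) * Matrix.fromBlocks A C D B
            = k • Delta p (m + 1)) :
    Aᵀ * D = Dᵀ * A ∧ Cᵀ * B = Bᵀ * C ∧ Aᵀ * B = Dᵀ * C + k • 1 := by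
  unfold Delta at h
  rw [fromBlocks_transpose, fromBlocks_multiply, fromBlocks_multiply, fromBlocks_smul,
    fromBlocks_inj] at h
  obtain ⟨h1, h2, h3, h4⟩ := h
  simp only [mul_zero, mul_neg, mul_one, zero_add, add_zero, neg_mul, smul_zero] at h1 h2 h3 h4
  refine ⟨?_, ?_, ?_⟩
  · rw [← sub_eq_zero, ← h1]; abel
  · rw [← sub_eq_zero, ← h4]; abel
  · rw [← h2]; abel

theorem s0_add (hodd : Odd p) {A B C D : Matrix (Fin (m + 1)) (Fin (m + 1)) (ZMod p)} {k : ZMod p}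
    (h : (Matrix.fromBlocks A C D B)ᵀ * Delta p (m + 1) * Matrix.fromBlocks A C D B
            = k • Delta p (m + 1)) (u u' w w' : Fin (m + 1) → ZMod p) :
    s0 A B C D (u + u') (w + w') + k * (u ⬝ᵥ w') = s0 A B C D u w + s0 A B C D u' w'
      + (A *ᵥ u + C *ᵥ w) ⬝ᵥ (D *ᵥ u' + B *ᵥ w') := by
  obtain ⟨h1, h2, h3⟩ := blocks h
  have two : (2 : ZMod p) ≠ 0 := by
    have hp : p.Prime := Fact.out
    intro h2
    have : ((2 : ℕ) : ZMod p) = 0 := by exact_mod_cast h2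
    rw [ZMod.natCast_eq_zero_iff] at this
    rw [(Nat.prime_dvd_prime_iff_eq hp Nat.prime_two).1 this] at hodd
    exact absurd hodd (by decide)
  have i2 : (2 : ZMod p)⁻¹ * 2 = 1 := inv_mul_cancel₀ two
  have e1 : (A *ᵥ u) ⬝ᵥ (D *ᵥ u') = (A *ᵥ u') ⬝ᵥ (D *ᵥ u) := by
    rw [← dot_tr, h1, dot_tr, dotProduct_comm]
  have e2 : (C *ᵥ w) ⬝ᵥ (B *ᵥ w') = (C *ᵥ w') ⬝ᵥ (B *ᵥ w) := by
    rw [← dot_tr, h2, dot_tr, dotProduct_comm]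
  have e3 : (A *ᵥ u) ⬝ᵥ (B *ᵥ w') = (C *ᵥ w') ⬝ᵥ (D *ᵥ u) + k * (u ⬝ᵥ w') := by
    rw [← dot_tr, h3, Matrix.add_mulVec, dotProduct_add, dot_tr, dotProduct_comm,
      Matrix.smul_mulVec, Matrix.one_mulVec, dotProduct_smul, smul_eq_mul]
  unfold s0
  simp only [dot_tr, Matrix.mulVec_add, add_dotProduct, dotProduct_add]
  rw [e3, ← e1, ← e2]
  linear_combination ((A *ᵥ u) ⬝ᵥ (D *ᵥ u') + (C *ᵥ w) ⬝ᵥ (B *ᵥ w')) * i2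

theorem wtilde_mk (a : ZMod (p ^ 2)) (u : Fin m → ZMod p) (v : Fin (m + 1) → ZMod p) :
    wtilde (⟨a, u, v 0, Fin.tail v⟩ : ES2 p m) = v := by
  unfold wtilde; exact Fin.cons_self_tail v

theorem utilde_mk {a : ZMod (p ^ 2)} {b} {c} {v : Fin (m + 1) → ZMod p} (h : red p a = v 0) :
    utilde (⟨a, Fin.tail v, b, c⟩ : ES2 p m) = v := by
  unfold utilde; rw [h]; exact Fin.cons_self_tail v

instance : Finite (ES2 p m) := by
  let f : ES2 p m → ZMod (p ^ 2) × (Fin m → ZMod p) × ZMod p × (Fin m → ZMod p) :=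
    fun x => (x.u1, x.u, x.w1, x.w)
  apply Finite.of_injective f
  intro x y h
  simp only [f, Prod.mk.injEq] at h
  exact ES2.ext h.1 h.2.1 h.2.2.1 h.2.2.2

theorem mul_utilde_zero {A C : Matrix (Fin (m + 1)) (Fin (m + 1)) (ZMod p)}
    (hA : ∀ j : Fin (m + 1), j ≠ 0 → A 0 j = 0) (hC : ∀ j : Fin (m + 1), C 0 j = 0)
    (u w : Fin (m + 1) → ZMod p) : (A *ᵥ u + C *ᵥ w) 0 = A 0 0 * u 0 := by
  simp [Matrix.mulVec, dotProduct, Fin.sum_univ_succ, hC, hA _ (Fin.succ_ne_zero _)]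

theorem backward (hodd : Odd p) (σ : ES2 p m → ES2 p m)
    (A B C D : Matrix (Fin (m + 1)) (Fin (m + 1)) (ZMod p)) (a : ZMod (p ^ 2))
    (α : (Fin m → ZMod p) →ₗ[ZMod p] ZMod p)
    (β : (Fin (m + 1) → ZMod p) →ₗ[ZMod p] ZMod p)
    (hM : IsUnit (Matrix.fromBlocks A C D B))
    (hS : (Matrix.fromBlocks A C D B)ᵀ * Delta p (m + 1) * Matrix.fromBlocks A C D B
            = A 0 0 • Delta p (m + 1))
    (hA : ∀ j : Fin (m + 1), j ≠ 0 → A 0 j = 0) (hC : ∀ j : Fin (m + 1), C 0 j = 0)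
    (ha : IsUnit a) (hra : red p a = A 0 0)
    (h1 : ∀ x, (σ x).u1 = a * x.u1 + emb p (α x.u + β (wtilde x)
      + s0 A B C D (utilde x) (wtilde x)))
    (h2 : ∀ x, utilde (σ x) = A *ᵥ utilde x + C *ᵥ wtilde x)
    (h3 : ∀ x, wtilde (σ x) = D *ᵥ utilde x + B *ᵥ wtilde x) :
    (∀ x y : ES2 p m, σ (x * y) = σ x * σ y) ∧ Function.Bijective σ := by
  constructor
  · intro x y
    apply ext_tilde
    · have hs := s0_add hodd hS (utilde x) (utilde y) (wtilde x) (wtilde y)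
      have hs' := congrArg (emb p) hs
      simp only [emb_add] at hs'
      rw [mul_u1_tilde, h1, h1, h1, h2, h3, mul_u1_tilde, ES2.mul_u, wtilde_mul, utilde_mul,
        map_add, map_add, mul_add, mul_emb, hra]
      simp only [emb_add]
      linear_combination hs'
    · simp only [utilde_mul, wtilde_mul, h2, Matrix.mulVec_add]; abel
    · simp only [utilde_mul, wtilde_mul, h3, Matrix.mulVec_add]; abel
  · rw [← Finite.injective_iff_bijective]
    intro x y hxy
    have hP : ∀ z, Pv (σ z) = Matrix.fromBlocks A C D B *ᵥ Pv z := by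
      intro z
      unfold Pv
      rw [fromBlocks_mulVec, h2, h3]
      simp only [Sum.elim_comp_inl, Sum.elim_comp_inr]
    have hinj := Matrix.mulVec_injective_of_isUnit hM
    have hPxy : Pv x = Pv y := by
      apply hinj
      show Matrix.fromBlocks A C D B *ᵥ Pv x = Matrix.fromBlocks A C D B *ᵥ Pv y
      rw [← hP, ← hP, hxy]
    obtain ⟨e1, e2⟩ := Pv_inj hPxy
    have eu : x.u = y.u := by
      funext j; simpa [utilde] using congrFun e1 j.succ
    have := congrArg ES2.u1 hxy
    rw [h1, h1, e1, e2, eu] at this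
    have := add_right_cancel this
    exact ext_tilde (ha.mul_left_cancel this) e1 e2

theorem moreover {A B C D : Matrix (Fin (m + 1)) (Fin (m + 1)) (ZMod p)}
    (hM : IsUnit (Matrix.fromBlocks A C D B))
    (hS : (Matrix.fromBlocks A C D B)ᵀ * Delta p (m + 1) * Matrix.fromBlocks A C D B
            = A 0 0 • Delta p (m + 1))
    (hA : ∀ j : Fin (m + 1), j ≠ 0 → A 0 j = 0) (hC : ∀ j : Fin (m + 1), C 0 j = 0) :
    B 0 0 = 1 ∧ ∀ i : Fin (m + 1), i ≠ 0 → B i 0 = 0 ∧ C i 0 = 0 := by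
  set M := Matrix.fromBlocks A C D B with hMdef
  have hMt : IsUnit Mᵀ := (Matrix.isUnit_transpose M).2 hM
  have hinj := Matrix.mulVec_injective_of_isUnit hMt
  have key : Delta p (m + 1) *ᵥ (M *ᵥ Pi.single (Sum.inr 0) 1) = Pi.single (Sum.inl 0) 1 := by
    apply hinj
    show Mᵀ *ᵥ _ = Mᵀ *ᵥ _
    rw [Matrix.mulVec_mulVec, Matrix.mulVec_mulVec, hS,
      Matrix.mulVec_single_one, Matrix.mulVec_single_one]
    funext i
    rcases i with i | i
    · by_cases hi : i = 0
      · subst hi; simp [Delta, hMdef]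
      · simp [Delta, hMdef, hi, hA i hi]
    · simp [Delta, hMdef, hC]
  rw [Matrix.mulVec_single_one] at key
  have kB : ∀ i, B i 0 = (Pi.single (Sum.inl 0) 1 : Fin (m+1) ⊕ Fin (m+1) → ZMod p) (Sum.inl i) := by
    intro i
    rw [← key]
    simp [Delta, Matrix.mulVec, dotProduct, hMdef, Matrix.one_apply]
  have kC : ∀ i, - C i 0 = (Pi.single (Sum.inl 0) 1 : Fin (m+1) ⊕ Fin (m+1) → ZMod p) (Sum.inr i) := by
    intro i
    rw [← key]
    simp [Delta, Matrix.mulVec, dotProduct, hMdef, Matrix.one_apply]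
  refine ⟨by simpa using kB 0, fun i hi => ⟨?_, ?_⟩⟩
  · rw [kB i, Pi.single_eq_of_ne]; simpa using hi
  · have := kC i
    rw [Pi.single_eq_of_ne (by simp)] at this
    simpa using this

theorem forward (hodd : Odd p) (σ : ES2 p m → ES2 p m)
    (hmul : ∀ x y : ES2 p m, σ (x * y) = σ x * σ y) (hb : Function.Bijective σ) :
    ∃ (A B C D : Matrix (Fin (m + 1)) (Fin (m + 1)) (ZMod p)) (a : ZMod (p ^ 2))
        (α : (Fin m → ZMod p) →ₗ[ZMod p] ZMod p)
        (β : (Fin (m + 1) → ZMod p) →ₗ[ZMod p] ZMod p),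
        IsUnit (Matrix.fromBlocks A C D B) ∧
        (Matrix.fromBlocks A C D B)ᵀ * Delta p (m + 1) * Matrix.fromBlocks A C D B
            = A 0 0 • Delta p (m + 1) ∧
        A 0 0 ≠ 0 ∧ (∀ j : Fin (m + 1), j ≠ 0 → A 0 j = 0) ∧
        (∀ j : Fin (m + 1), C 0 j = 0) ∧
        IsUnit a ∧ red p a = A 0 0 ∧
        ∀ x : ES2 p m, (σ x).u1 = a * x.u1 + emb p (α x.u + β (wtilde x)
            + s0 A B C D (utilde x) (wtilde x)) ∧
          utilde (σ x) = A *ᵥ utilde x + C *ᵥ wtilde x ∧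
          wtilde (σ x) = D *ᵥ utilde x + B *ᵥ wtilde x := by
  let F : ES2 p m →* ES2 p m := MonoidHom.mk' σ hmul
  have hF : ∀ x, F x = σ x := fun _ => rfl
  -- standard elements
  let X : ES2 p m := liftv (Pi.single (Sum.inl 0) 1)
  let Y : ZMod p → ES2 p m := fun c => liftv (Pi.single (Sum.inr 0) c)
  have hXY : ∀ c, om X (Y c) = c := by
    intro c
    rw [om_Delta, Pv_liftv, Pv_liftv]
    simp [Delta]
  have hcomm : ∀ x y, σ (zc (om x y)) = zc (om (σ x) (σ y)) := by
    intro x y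
    have h1 := congrArg σ (mul_comm_zc x y)
    rw [hmul, hmul (zc _), hmul y x, mul_comm_zc (σ x)] at h1
    exact (mul_right_cancel h1).symm
  have hz : ∀ c, ∃ d, σ (zc c) = zc d := fun c => by
    have h1 := hcomm X (Y c)
    rw [hXY] at h1
    exact ⟨_, h1⟩
  choose g hg using hz
  have gadd : ∀ c d, g (c + d) = g c + g d := by
    intro c d
    apply zc_inj (p := p) (m := m)
    rw [← hg, zc_add, hmul, hg, hg, ← zc_add]
  let G : ZMod p →+ ZMod p := AddMonoidHom.mk' g gadd
  let k := g 1
  have hgk : ∀ c, g c = k * c := by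
    intro c
    have := (G.toZModLinearMap p).map_smul c 1
    simp only [smul_eq_mul, mul_one] at this
    calc g c = c * g 1 := this
      _ = k * c := mul_comm _ _
  have hk : k ≠ 0 := by
    intro h0
    have h1 : σ (zc 1) = σ (zc 0) := by
      rw [hg, hg, hgk, hgk, h0]; simp
    exact one_ne_zero (zc_inj (hb.1 h1))
  -- the linear map
  have Pz : ∀ c, Pv (zc c : ES2 p m) = 0 := by
    intro c; funext i
    rcases i with i | i <;> simp [Pv, utilde_zc, wtilde_zc]
  have hfac : ∀ x y, Pv x = Pv y → Pv (σ x) = Pv (σ y) := by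
    intro x y h
    obtain ⟨c, rfl⟩ := eq_zc_mul h
    rw [hmul, hg, Pv_mul, Pz, zero_add]
  let L : (Fin (m + 1) ⊕ Fin (m + 1) → ZMod p) →+ (Fin (m + 1) ⊕ Fin (m + 1) → ZMod p) :=
    AddMonoidHom.mk' (fun v => Pv (σ (liftv v))) (by
      intro v w
      rw [← Pv_mul, ← hmul]
      apply hfac
      rw [Pv_mul, Pv_liftv, Pv_liftv, Pv_liftv])
  let M := LinearMap.toMatrix' (L.toZModLinearMap p)
  have hM : ∀ x, Pv (σ x) = M *ᵥ Pv x := by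
    intro x
    rw [LinearMap.toMatrix'_mulVec]
    show _ = Pv (σ (liftv (Pv x)))
    apply hfac
    rw [Pv_liftv]
  have hS : Mᵀ * Delta p (m + 1) * M = k • Delta p (m + 1) := by
    apply Matrix.ext_of_mulVec_single
    intro j
    apply dotProduct_eq
    intro v
    rw [dotProduct_comm, dotProduct_comm _ v]
    have h1 := hcomm (liftv v) (liftv (Pi.single j 1))
    rw [hg] at h1
    have h2 := zc_inj h1
    rw [hgk, om_Delta, om_Delta, hM, hM, Pv_liftv, Pv_liftv] at h2
    rw [Matrix.smul_mulVec, dotProduct_smul, smul_eq_mul, h2, Matrix.mul_assoc,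
      ← Matrix.mulVec_mulVec, Matrix.dotProduct_mulVec, Matrix.vecMul_transpose,
      Matrix.mulVec_mulVec]
  have h0 : ∀ x, utilde (σ x) 0 = k * utilde x 0 := by
    intro x
    have h1 := congrArg F (pow_p hodd x)
    rw [map_pow, hF, hF, pow_p hodd, hg, hgk] at h1
    exact zc_inj h1
  have hrow : ∀ v, (M *ᵥ v) (Sum.inl 0) = k * v (Sum.inl 0) := by
    intro v
    have := h0 (liftv v)
    have e1 := congrFun (hM (liftv v)) (Sum.inl 0)
    rw [Pv_liftv] at e1
    rw [← e1]
    have e2 := congrFun (Pv_liftv v) (Sum.inl 0)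
    rw [← e2]
    exact this
  have hrow' : ∀ j, M (Sum.inl 0) j = k * (Pi.single j 1 : _ → ZMod p) (Sum.inl 0) := by
    intro j
    rw [← hrow, Matrix.mulVec_single_one]; rfl
  obtain ⟨A, C, D, B, hMB⟩ : ∃ A C D B, M = Matrix.fromBlocks A C D B :=
    ⟨_, _, _, _, (Matrix.fromBlocks_toBlocks M).symm⟩
  have hA00 : A 0 0 = k := by
    have := hrow' (Sum.inl 0)
    rw [hMB] at this; simpa using this
  have hA : ∀ j : Fin (m + 1), j ≠ 0 → A 0 j = 0 := by
    intro j hj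
    have := hrow' (Sum.inl j)
    rw [hMB, Pi.single_eq_of_ne (by simpa using hj.symm)] at this; simpa using this
  have hC : ∀ j : Fin (m + 1), C 0 j = 0 := by
    intro j
    have := hrow' (Sum.inr j)
    rw [hMB, Pi.single_eq_of_ne (by simp)] at this; simpa using this
  have hinjM : Function.Injective M.mulVec := by
    intro v w h
    have h' : M *ᵥ v = M *ᵥ w := h
    have : ∀ t, (Mᵀ * Delta p (m + 1) * M) *ᵥ t = Mᵀ *ᵥ (Delta p (m + 1) *ᵥ (M *ᵥ t)) := by
      intro t; simp only [Matrix.mulVec_mulVec, Matrix.mul_assoc]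
    have h2 : k • (Delta p (m + 1) *ᵥ v) = k • (Delta p (m + 1) *ᵥ w) := by
      rw [← Matrix.smul_mulVec, ← Matrix.smul_mulVec, ← hS, this, this, h']
    have h3 := smul_right_injective _ hk h2
    simp only [Delta, fromBlocks_mulVec] at h3
    funext i
    rcases i with i | i
    · have := congrFun h3 (Sum.inr i)
      simpa [Matrix.neg_mulVec] using this
    · have := congrFun h3 (Sum.inl i)
      simpa using this
  have hunit : IsUnit M := Matrix.mulVec_injective_iff_isUnit.1 hinjM
  rw [hMB] at hunit hS
  have hU : ∀ x, utilde (σ x) = A *ᵥ utilde x + C *ᵥ wtilde x := by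
    intro x
    funext i
    have := congrFun (hM x) (Sum.inl i)
    rw [hMB, fromBlocks_mulVec] at this
    simpa [Pv] using this
  have hW : ∀ x, wtilde (σ x) = D *ᵥ utilde x + B *ᵥ wtilde x := by
    intro x
    funext i
    have := congrFun (hM x) (Sum.inr i)
    rw [hMB, fromBlocks_mulVec] at this
    simpa [Pv] using this
  -- first component
  let h : ES2 p m → ZMod (p ^ 2) := fun x => (σ x).u1 - emb p (s0 A B C D (utilde x) (wtilde x))
  have hh : ∀ x y, h (x * y) = h x + h y + emb p (k * (utilde x ⬝ᵥ wtilde y)) := by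
    intro x y
    have hs' := congrArg (emb p) (s0_add hodd hS (utilde x) (utilde y) (wtilde x) (wtilde y))
    simp only [emb_add] at hs'
    simp only [h]
    rw [hmul, mul_u1_tilde, utilde_mul, wtilde_mul, hU, hW]
    linear_combination -hs'
  let e : ZMod (p ^ 2) → ES2 p m := fun t => ⟨t, 0, 0, 0⟩
  have we : ∀ t, wtilde (e t) = 0 := fun t => by
    funext i
    refine Fin.cases ?_ (fun j => ?_) i <;> simp [wtilde, e]
  have eadd : ∀ s t, e (s + t) = e s * e t := by
    intro s t; ext <;> simp [e, emb_zero]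
  let H : ZMod (p ^ 2) →+ ZMod (p ^ 2) := AddMonoidHom.mk' (fun t => h (e t)) (by
    intro s t
    rw [eadd, hh, we, dotProduct_zero, mul_zero, emb_zero, add_zero])
  let a := h (e 1)
  have ha : ∀ t, h (e t) = a * t := by
    intro t
    have := (H.toZModLinearMap (p ^ 2)).map_smul t 1
    simp only [smul_eq_mul, mul_one] at this
    calc h (e t) = t * h (e 1) := this
      _ = a * t := mul_comm _ _
  have hred : ∀ x, red p (h x) = k * red p x.u1 := by
    intro x
    have := h0 x
    simp only [h, map_sub, red_emb, sub_zero]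
    simpa [utilde] using this
  have hra : red p a = k := by
    simp only [a]; rw [hred]; simp [e]
  have hq : ∀ x, ∃ c, h x - a * x.u1 = emb p c := by
    intro x
    apply exists_emb_of_red
    rw [map_sub, map_mul, hred, hra, sub_self]
  choose q hq using hq
  have qmul : ∀ x y, q (x * y) = q x + q y := by
    intro x y
    apply emb_inj
    rw [emb_add, ← hq, ← hq, ← hq, hh, mul_u1_tilde, ← hra, ← mul_emb]
    ring
  have qe : ∀ t, q (e t) = 0 := by
    intro t
    apply emb_inj
    rw [← hq, ha, emb_zero]; simp [e]
  let α0 : (Fin m → ZMod p) →+ ZMod p := AddMonoidHom.mk' (fun u => q ⟨0, u, 0, 0⟩) (by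
    intro u v
    rw [← qmul]; congr 1; ext <;> simp [emb_zero])
  let β0 : (Fin (m + 1) → ZMod p) →+ ZMod p :=
    AddMonoidHom.mk' (fun w => q ⟨0, 0, w 0, Fin.tail w⟩) (by
    intro u v
    rw [← qmul]; congr 1; ext <;> simp [emb_zero, Fin.tail])
  refine ⟨A, B, C, D, a, α0.toZModLinearMap p, β0.toZModLinearMap p, hunit, ?_, ?_, hA, hC, ?_, ?_,
    fun x => ⟨?_, hU x, hW x⟩⟩
  · rw [hA00, hS]
  · rw [hA00]; exact hk
  · apply isUnit_of_red; rw [hra]; exact hk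
  · rw [hra, hA00]
  · have hqx : q x = q ⟨0, x.u, 0, 0⟩ + q ⟨0, 0, x.w1, x.w⟩ := by
      have : x = ⟨0, 0, x.w1, x.w⟩ * (⟨0, x.u, 0, 0⟩ * e x.u1) := by
        ext <;> simp [e, emb_zero]
      conv_lhs => rw [this]
      rw [qmul, qmul, qe]; ring
    have h1 : (α0.toZModLinearMap p) x.u = q ⟨0, x.u, 0, 0⟩ := rfl
    have h2 : (β0.toZModLinearMap p) (wtilde x) = q ⟨0, 0, x.w1, x.w⟩ := by
      show q ⟨0, 0, wtilde x 0, Fin.tail (wtilde x)⟩ = _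
      simp [wtilde]
    rw [h1, h2, ← hqx, emb_add, ← hq]
    simp only [h]; ring

end Helpers

theorem ES2_automorphism_iff (p m : ℕ) [Fact p.Prime] (hodd : Odd p)
    (σ : ES2 p m → ES2 p m) :
    (((∀ x y : ES2 p m, σ (x * y) = σ x * σ y) ∧ Function.Bijective σ) ↔
      ∃ (A B C D : Matrix (Fin (m + 1)) (Fin (m + 1)) (ZMod p)) (a : ZMod (p ^ 2))
        (α : (Fin m → ZMod p) →ₗ[ZMod p] ZMod p)
        (β : (Fin (m + 1) → ZMod p) →ₗ[ZMod p] ZMod p),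
        IsUnit (Matrix.fromBlocks A C D B) ∧
        (Matrix.fromBlocks A C D B)ᵀ * Delta p (m + 1) * Matrix.fromBlocks A C D B
            = A 0 0 • Delta p (m + 1) ∧
        A 0 0 ≠ 0 ∧ (∀ j : Fin (m + 1), j ≠ 0 → A 0 j = 0) ∧
        (∀ j : Fin (m + 1), C 0 j = 0) ∧
        IsUnit a ∧ red p a = A 0 0 ∧
        ∀ x : ES2 p m,
          σ x = ⟨a * x.u1 + emb p (α x.u + β (wtilde x)
                + (2 : ZMod p)⁻¹ * (utilde x ⬝ᵥ ((Aᵀ * D) *ᵥ utilde x))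
                + (2 : ZMod p)⁻¹ * (wtilde x ⬝ᵥ ((Cᵀ * B) *ᵥ wtilde x))
                + wtilde x ⬝ᵥ ((Cᵀ * D) *ᵥ utilde x)),
              Fin.tail (A *ᵥ utilde x + C *ᵥ wtilde x),
              (D *ᵥ utilde x + B *ᵥ wtilde x) 0,
              Fin.tail (D *ᵥ utilde x + B *ᵥ wtilde x)⟩) ∧
    (∀ (A B C D : Matrix (Fin (m + 1)) (Fin (m + 1)) (ZMod p)) (a : ZMod (p ^ 2))
        (α : (Fin m → ZMod p) →ₗ[ZMod p] ZMod p)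
        (β : (Fin (m + 1) → ZMod p) →ₗ[ZMod p] ZMod p),
        IsUnit (Matrix.fromBlocks A C D B) →
        (Matrix.fromBlocks A C D B)ᵀ * Delta p (m + 1) * Matrix.fromBlocks A C D B
            = A 0 0 • Delta p (m + 1) →
        A 0 0 ≠ 0 → (∀ j : Fin (m + 1), j ≠ 0 → A 0 j = 0) →
        (∀ j : Fin (m + 1), C 0 j = 0) →
        IsUnit a → red p a = A 0 0 →
        (∀ x : ES2 p m,
          σ x = ⟨a * x.u1 + emb p (α x.u + β (wtilde x)
                + (2 : ZMod p)⁻¹ * (utilde x ⬝ᵥ ((Aᵀ * D) *ᵥ utilde x))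
                + (2 : ZMod p)⁻¹ * (wtilde x ⬝ᵥ ((Cᵀ * B) *ᵥ wtilde x))
                + wtilde x ⬝ᵥ ((Cᵀ * D) *ᵥ utilde x)),
              Fin.tail (A *ᵥ utilde x + C *ᵥ wtilde x),
              (D *ᵥ utilde x + B *ᵥ wtilde x) 0,
              Fin.tail (D *ᵥ utilde x + B *ᵥ wtilde x)⟩) →
        B 0 0 = 1 ∧ ∀ i : Fin (m + 1), i ≠ 0 → B i 0 = 0 ∧ C i 0 = 0) := by
  have aux : ∀ (A B C D : Matrix (Fin (m + 1)) (Fin (m + 1)) (ZMod p)) (a : ZMod (p ^ 2))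
      (α : (Fin m → ZMod p) →ₗ[ZMod p] ZMod p)
      (β : (Fin (m + 1) → ZMod p) →ₗ[ZMod p] ZMod p) (x : ES2 p m),
      (α x.u + β (wtilde x)
                + (2 : ZMod p)⁻¹ * (utilde x ⬝ᵥ ((Aᵀ * D) *ᵥ utilde x))
                + (2 : ZMod p)⁻¹ * (wtilde x ⬝ᵥ ((Cᵀ * B) *ᵥ wtilde x))
                + wtilde x ⬝ᵥ ((Cᵀ * D) *ᵥ utilde x)) =
      α x.u + β (wtilde x) + s0 A B C D (utilde x) (wtilde x) := by
    intros; unfold s0; ring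
  have auxu : ∀ (A C : Matrix (Fin (m + 1)) (Fin (m + 1)) (ZMod p)) (a : ZMod (p ^ 2))
      (c : ZMod p) (x : ES2 p m), (∀ j : Fin (m + 1), j ≠ 0 → A 0 j = 0) →
        (∀ j : Fin (m + 1), C 0 j = 0) → red p a = A 0 0 →
      red p (a * x.u1 + emb p c) = (A *ᵥ utilde x + C *ᵥ wtilde x) 0 := by
    intro A C a c x hA hC hra
    rw [mul_utilde_zero hA hC, map_add, map_mul, red_emb, hra, add_zero]
    rfl
  refine ⟨⟨?_, ?_⟩, ?_⟩
  · rintro ⟨hmul, hb⟩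
    obtain ⟨A, B, C, D, a, α, β, h1, h2, h3, h4, h5, h6, h7, h8⟩ := forward hodd σ hmul hb
    refine ⟨A, B, C, D, a, α, β, h1, h2, h3, h4, h5, h6, h7, fun x => ?_⟩
    obtain ⟨k1, k2, k3⟩ := h8 x
    rw [aux A B C D a]
    apply ext_tilde
    · exact k1
    · rw [utilde_mk (auxu A C a _ x h4 h5 h7), k2]
    · rw [wtilde_mk, k3]
  · rintro ⟨A, B, C, D, a, α, β, h1, h2, h3, h4, h5, h6, h7, h8⟩
    refine backward hodd σ A B C D a α β h1 h2 h4 h5 h6 h7 ?_ ?_ ?_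
    · intro x
      rw [h8, ← aux A B C D a]
    · intro x
      rw [h8, utilde_mk (auxu A C a _ x h4 h5 h7)]
    · intro x
      rw [h8, wtilde_mk]
  · intro A B C D a α β h1 h2 _ h4 h5 _ _ _
    exact moreover h1 h2 h4 h5
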